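/- Let λ_B > 0 and δ > 0, and define M(r, δ) = π r² − (2·arcsin(δ/(2r)) + arccos(δ/(2r)))·r² + δ·√(r² − δ²/4) for r > δ/2 and M(r, δ) = 0 for 0 < r ≤ δ/2. Then there exists a unique λ* > 0 such that ∫₀^∞ 2r·((1 − exp(−λ_B π δ²))/δ²)·exp(−λ*·M(r, δ)) dr = 1. -/

import Mathlib

open MeasureTheory Real

/-- The function `M(r, δ)` of equation (28) of the paper. -/
noncomputable def Mhc (r δ : ℝ) : ℝ :=
  if δ / 2 < r then
    π * r ^ 2 - (2 * Real.arcsin (δ / (2 * r)) + Real.arccos (δ / (2 * r))) * r ^ 2 +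
      δ * Real.sqrt (r ^ 2 - δ ^ 2 / 4)
  else 0

theorem Mhc_of_lt {r δ : ℝ} (h : δ / 2 < r) :
    Mhc r δ = Real.arccos (δ / (2 * r)) * r ^ 2 + δ * Real.sqrt (r ^ 2 - δ ^ 2 / 4) := by
  rw [Mhc, if_pos h, Real.arccos]
  ring

theorem Mhc_of_le {r δ : ℝ} (h : r ≤ δ / 2) : Mhc r δ = 0 := by
  rw [Mhc, if_neg h.not_gt]

theorem Mhc_nonneg {r δ : ℝ} (hδ : 0 < δ) : 0 ≤ Mhc r δ := by
  rcases le_or_gt r (δ / 2) with h | h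
  · rw [Mhc_of_le h]
  · rw [Mhc_of_lt h]
    have := Real.arccos_nonneg (δ / (2 * r))
    positivity

theorem sq_sub_le_Mhc {r δ : ℝ} (hδ : 0 < δ) (hr : 0 < r) : r ^ 2 - δ ^ 2 / 4 ≤ Mhc r δ := by
  rcases le_or_gt r (δ / 2) with h | h
  · rw [Mhc_of_le h]
    nlinarith
  rw [Mhc_of_lt h]
  rcases le_or_gt r δ with h' | h'
  · have h1 : 0 ≤ r ^ 2 - δ ^ 2 / 4 := by nlinarith
    have h2 : Real.sqrt (r ^ 2 - δ ^ 2 / 4) ≤ δ := by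
      rw [Real.sqrt_le_left hδ.le]
      nlinarith
    have h3 := Real.mul_self_sqrt h1
    have h4 := Real.sqrt_nonneg (r ^ 2 - δ ^ 2 / 4)
    have h5 := mul_nonneg (Real.arccos_nonneg (δ / (2 * r))) (sq_nonneg r)
    nlinarith [mul_le_mul_of_nonneg_right h2 h4]
  · have h1 : δ / (2 * r) ≤ 1 / 2 := by
      rw [div_le_div_iff₀ (by positivity) (by norm_num)]
      linarith
    have h2 : π / 3 ≤ Real.arccos (δ / (2 * r)) := by
      rw [← Real.arccos_cos (x := π / 3) (by positivity) (by linarith [Real.pi_pos]),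
        Real.cos_pi_div_three]
      exact Real.arccos_le_arccos h1
    have h3 : 1 ≤ Real.arccos (δ / (2 * r)) := by linarith [Real.pi_gt_three]
    have h4 : 0 ≤ δ * Real.sqrt (r ^ 2 - δ ^ 2 / 4) := by positivity
    nlinarith [mul_le_mul_of_nonneg_right h3 (sq_nonneg r), sq_nonneg δ]

theorem Mhc_le {r δ : ℝ} (hδ : 0 < δ) : Mhc r δ ≤ 4 * r ^ 2 := by
  rcases le_or_gt r (δ / 2) with h | h
  · rw [Mhc_of_le h]
    positivity
  have hr : 0 < r := by linarith
  rw [Mhc_of_lt h]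
  have h1 : Real.arccos (δ / (2 * r)) ≤ 2 := by
    have : Real.arccos (δ / (2 * r)) ≤ π / 2 := Real.arccos_le_pi_div_two.2 (by positivity)
    linarith [Real.pi_le_four]
  have h2 : Real.sqrt (r ^ 2 - δ ^ 2 / 4) ≤ r := by
    rw [Real.sqrt_le_left hr.le]
    nlinarith
  nlinarith [mul_le_mul_of_nonneg_right h1 (sq_nonneg r), mul_le_mul_of_nonneg_left h2 hδ.le]

theorem measurable_Mhc (δ : ℝ) : Measurable fun r => Mhc r δ := by
  unfold Mhc
  refine Measurable.ite measurableSet_Ioi ?_ measurable_const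
  have h : Measurable fun r : ℝ => δ / (2 * r) := by fun_prop
  have h1 := Real.measurable_arcsin.comp h
  have h2 := Real.measurable_arccos.comp h
  exact (((measurable_const.mul (measurable_id.pow_const 2)).sub
    (((h1.const_mul 2).add h2).mul (measurable_id.pow_const 2))).add
    (((measurable_id.pow_const 2).sub_const _).sqrt.const_mul δ))

theorem integrable_two_mul_mul_exp_neg_mul_sq {l : ℝ} (hl : 0 < l) :
    Integrable fun r : ℝ => 2 * r * Real.exp (-l * r ^ 2) := by
  simpa only [mul_assoc] using (integrable_mul_exp_neg_mul_sq hl).const_mul 2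

theorem integral_Ioi_two_mul_mul_exp_neg_mul_sq {l : ℝ} (hl : 0 < l) (t : ℝ) :
    ∫ r in Set.Ioi t, 2 * r * Real.exp (-l * r ^ 2) = Real.exp (-l * t ^ 2) / l := by
  have hderiv : ∀ x ∈ Set.Ici t,
      HasDerivAt (fun r : ℝ => -(Real.exp (-l * r ^ 2) / l)) (2 * x * Real.exp (-l * x ^ 2)) x := by
    intro x _
    have h := ((((hasDerivAt_pow 2 x).const_mul (-l)).exp).div_const l).fun_neg
    refine h.congr_deriv ?_
    push_cast
    field_simp
  have hlim : Filter.Tendsto (fun r : ℝ => -(Real.exp (-l * r ^ 2) / l)) Filter.atTop (nhds 0) := by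
    have h : Filter.Tendsto (fun r : ℝ => -l * r ^ 2) Filter.atTop Filter.atBot :=
      (Filter.tendsto_pow_atTop two_ne_zero).const_mul_atTop_of_neg (neg_lt_zero.2 hl)
    simpa using ((Real.tendsto_exp_atBot.comp h).div_const l).neg
  rw [integral_Ioi_of_hasDerivAt_of_tendsto' hderiv
    (integrable_two_mul_mul_exp_neg_mul_sq hl).integrableOn hlim]
  ring

/-- The density of the nearest-point distance with unit prefactor. -/
noncomputable def nearestKernel (δ l r : ℝ) : ℝ := 2 * r * Real.exp (-l * Mhc r δ)

theorem measurable_nearestKernel (δ l : ℝ) : Measurable (nearestKernel δ l) := by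
  unfold nearestKernel
  exact (measurable_id.const_mul 2).mul ((measurable_Mhc δ).const_mul (-l)).exp

theorem nearestKernel_le {δ l r : ℝ} (hδ : 0 < δ) (hl : 0 < l) (hr : 0 < r) :
    nearestKernel δ l r ≤ Real.exp (l * (δ ^ 2 / 4)) * (2 * r * Real.exp (-l * r ^ 2)) := by
  rw [nearestKernel, mul_left_comm, ← Real.exp_add]
  gcongr
  nlinarith [mul_le_mul_of_nonneg_left (sq_sub_le_Mhc hδ hr) hl.le]

theorem nearestKernel_anti {δ a b r : ℝ} (hδ : 0 < δ) (hab : a ≤ b) (hr : 0 < r) :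
    nearestKernel δ b r ≤ nearestKernel δ a r := by
  unfold nearestKernel
  gcongr
  exact Mhc_nonneg hδ

theorem integrableOn_nearestKernel {δ l : ℝ} (hδ : 0 < δ) (hl : 0 < l) :
    IntegrableOn (nearestKernel δ l) (Set.Ioi 0) := by
  refine Integrable.mono' (((integrable_two_mul_mul_exp_neg_mul_sq hl).const_mul
    (Real.exp (l * (δ ^ 2 / 4)))).integrableOn)
    (measurable_nearestKernel δ l).aestronglyMeasurable ?_
  refine (ae_restrict_iff' measurableSet_Ioi).2 (.of_forall fun r (hr : 0 < r) => ?_)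
  rw [Real.norm_of_nonneg (by unfold nearestKernel; positivity)]
  exact nearestKernel_le hδ hl hr

theorem integral_nearestKernel_strictAntiOn {δ : ℝ} (hδ : 0 < δ) :
    StrictAntiOn (fun l => ∫ r in Set.Ioi (0 : ℝ), nearestKernel δ l r) (Set.Ioi 0) := by
  intro a ha b hb hab
  have hia := integrableOn_nearestKernel hδ ha
  have hib := integrableOn_nearestKernel hδ hb
  rw [← sub_pos, ← integral_sub hia hib, integral_pos_iff_support_of_nonneg_ae
    ((ae_restrict_iff' measurableSet_Ioi).2
      (.of_forall fun r hr => sub_nonneg.2 (nearestKernel_anti hδ hab.le hr))) (hia.sub hib)]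
  have hsub : Set.Ioi (δ / 2) ⊆
      Function.support fun r => nearestKernel δ a r - nearestKernel δ b r := by
    intro r (hr : δ / 2 < r)
    have hr0 : 0 < r := by linarith
    have hM : 0 < Mhc r δ := lt_of_lt_of_le (by nlinarith) (sq_sub_le_Mhc hδ hr0)
    refine (sub_pos.2 ?_).ne'
    unfold nearestKernel
    gcongr
  refine lt_of_lt_of_le ?_ (measure_mono hsub)
  rw [Measure.restrict_apply measurableSet_Ioi, Set.Ioi_inter_Ioi, Real.volume_Ioi]
  exact ENNReal.zero_lt_top

theorem continuousOn_integral_nearestKernel {δ a : ℝ} (hδ : 0 < δ) (ha : 0 < a) :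
    ContinuousOn (fun l => ∫ r in Set.Ioi (0 : ℝ), nearestKernel δ l r) (Set.Ici a) := by
  refine continuousOn_of_dominated (bound := nearestKernel δ a)
    (fun l _ => (measurable_nearestKernel δ l).aestronglyMeasurable) (fun l hl => ?_)
    (integrableOn_nearestKernel hδ ha) (.of_forall fun r => ?_)
  · refine (ae_restrict_iff' measurableSet_Ioi).2 (.of_forall fun r (hr : 0 < r) => ?_)
    rw [Real.norm_of_nonneg (by unfold nearestKernel; positivity)]
    exact nearestKernel_anti hδ hl hr
  · unfold nearestKernel
    fun_prop

theorem le_integral_nearestKernel {δ l : ℝ} (hδ : 0 < δ) (hl : 0 < l) :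
    1 / (4 * l) ≤ ∫ r in Set.Ioi (0 : ℝ), nearestKernel δ l r := by
  have h4 : 0 < 4 * l := by positivity
  have h := integral_Ioi_two_mul_mul_exp_neg_mul_sq h4 0
  simp only [ne_eq, OfNat.ofNat_ne_zero, not_false_eq_true, zero_pow, mul_zero, Real.exp_zero] at h
  rw [← h]
  refine setIntegral_mono_on (integrable_two_mul_mul_exp_neg_mul_sq h4).integrableOn
    (integrableOn_nearestKernel hδ hl) measurableSet_Ioi fun r (hr : 0 < r) => ?_
  have hexp : -(4 * l) * r ^ 2 ≤ -l * Mhc r δ := by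
    nlinarith [mul_le_mul_of_nonneg_left (Mhc_le (r := r) hδ) hl.le]
  exact mul_le_mul_of_nonneg_left (Real.exp_le_exp.2 hexp) (by positivity)

theorem integral_nearestKernel_le {δ l : ℝ} (hδ : 0 < δ) (hl : 0 < l) :
    ∫ r in Set.Ioi (0 : ℝ), nearestKernel δ l r ≤ δ ^ 2 / 4 + 1 / l := by
  have hδ2 : 0 < δ / 2 := by positivity
  have hint := integrableOn_nearestKernel hδ hl
  have hsub : Set.Ioi (δ / 2) ⊆ Set.Ioi 0 := Set.Ioi_subset_Ioi hδ2.le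
  rw [← Set.Ioc_union_Ioi_eq_Ioi hδ2.le, setIntegral_union Set.Ioc_disjoint_Ioi_same
    measurableSet_Ioi (hint.mono_set Set.Ioc_subset_Ioi_self) (hint.mono_set hsub)]
  refine add_le_add (le_of_eq ?_) ?_
  · have h : ∀ r ∈ Set.Ioc 0 (δ / 2), nearestKernel δ l r = 2 * r := fun r hr => by
      simp [nearestKernel, Mhc_of_le hr.2]
    rw [setIntegral_congr_fun measurableSet_Ioc h, ← intervalIntegral.integral_of_le hδ2.le,
      intervalIntegral.integral_const_mul, integral_id]
    ring
  · calc ∫ r in Set.Ioi (δ / 2), nearestKernel δ l r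
        ≤ ∫ r in Set.Ioi (δ / 2),
            Real.exp (l * (δ ^ 2 / 4)) * (2 * r * Real.exp (-l * r ^ 2)) :=
          setIntegral_mono_on (hint.mono_set hsub)
            ((integrable_two_mul_mul_exp_neg_mul_sq hl).const_mul _).integrableOn
            measurableSet_Ioi fun r hr => nearestKernel_le hδ hl (hsub hr)
      _ = 1 / l := by
          rw [integral_const_mul, integral_Ioi_two_mul_mul_exp_neg_mul_sq hl, ← mul_div_assoc,
            ← Real.exp_add]
          ring_nf
          simp

/-- There is a unique `λ* > 0` making the approximate nearest-active-BS distance density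
`f(r) = 2r ((1 − exp(−λ_B π δ²))/δ²) exp(−λ* M(r,δ))` of equations (27)–(28) a proper
probability density, i.e. integrate to `1` over `(0, ∞)`. -/
theorem exists_unique_active_intensity (lamB δ : ℝ) (hlamB : 0 < lamB) (hδ : 0 < δ) :
    ∃! l : ℝ, 0 < l ∧
      ∫ r in Set.Ioi (0 : ℝ),
        2 * r * ((1 - Real.exp (-(lamB * π * δ ^ 2))) / δ ^ 2) * Real.exp (-l * Mhc r δ) = 1 := by
  have hp0 : Real.exp (-(lamB * π * δ ^ 2)) < 1 := Real.exp_lt_one_iff.2 (by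
    have : 0 < lamB * π * δ ^ 2 := by positivity
    linarith)
  set c := (1 - Real.exp (-(lamB * π * δ ^ 2))) / δ ^ 2 with hc
  have hc0 : 0 < c := div_pos (by linarith) (by positivity)
  have hcδ : c * δ ^ 2 < 1 := by
    rw [hc, div_mul_cancel₀ _ (by positivity)]
    linarith [Real.exp_pos (-(lamB * π * δ ^ 2))]
  have hF : ∀ l : ℝ, ∫ r in Set.Ioi (0 : ℝ), 2 * r * c * Real.exp (-l * Mhc r δ) =
      c * ∫ r in Set.Ioi (0 : ℝ), nearestKernel δ l r := fun l => by
    rw [← integral_const_mul]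
    congr 1 with r
    rw [nearestKernel]
    ring
  have hone : ∀ x : ℝ, c * x = 1 ↔ x = 1 / c := fun x => by
    rw [eq_div_iff hc0.ne', mul_comm]
  simp only [hF, hone]
  have hlow : 1 / c ≤ ∫ r in Set.Ioi (0 : ℝ), nearestKernel δ (c / 4) r := by
    simpa [mul_div_cancel₀] using le_integral_nearestKernel (l := c / 4) hδ (by positivity)
  have hhigh : ∫ r in Set.Ioi (0 : ℝ), nearestKernel δ (2 * c) r ≤ 1 / c := by
    refine (integral_nearestKernel_le (l := 2 * c) hδ (by positivity)).trans ?_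
    rw [le_div_iff₀ hc0]
    have : (δ ^ 2 / 4 + 1 / (2 * c)) * c = c * δ ^ 2 / 4 + 1 / 2 := by field_simp
    linarith
  have hcont := (continuousOn_integral_nearestKernel (a := c / 4) hδ (by positivity)).mono
    (Set.Icc_subset_Ici_self : Set.Icc (c / 4) (2 * c) ⊆ _)
  obtain ⟨l, hl, hl1⟩ := intermediate_value_Icc' (by linarith) hcont ⟨hhigh, hlow⟩
  have hl0 : 0 < l := lt_of_lt_of_le (by positivity) hl.1
  exact ⟨l, ⟨hl0, hl1⟩, fun m ⟨hm0, hm1⟩ =>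
    (integral_nearestKernel_strictAntiOn hδ).injOn hm0 hl0 (hm1.trans hl1.symm)⟩
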